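/- Let a group G act without inversion on locally finite pocsets P and P', let f : P → P' be a G-equivariant resolution, and let φ : P → P/∼ be an elementary fold of f. Let ĥ, k̂, l̂ be hyperplanes of P such that k̂ separates ĥ and l̂, the images f(ĥ), f(k̂), f(l̂) are pairwise non-transverse in P', and the class [k̂] does not separate [ĥ] and [l̂] in P/∼. Then one of the following holds: (1) ĥ ∼ k̂; (2) l̂ ∼ k̂; (3) the hyperplanes [ĥ], [k̂], [l̂] of P/∼ form a facing triple (i.e. they admit orientations that are pairwise facing). Moreover, in case (3) there are exactly two elements of the class [k̂] that separate ĥ and l̂. -/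

import Mathlib

/- Pocsets, hyperplanes, admissible equivalence relations, quotients,
   admissible maps, embeddings, resolutions, group actions on pocsets,
   elementary folds and folding sequences. -/

universe u v w

/-- A pocset: a poset with an order-reversing involution `star` such that
`h ≠ h *` and `h`, `h *` are incomparable. -/
structure Pocset (P : Type u) where
  le : P → P → Prop
  star : P → P
  le_refl : ∀ a, le a a
  le_trans : ∀ {a b c}, le a b → le b c → le a c
  le_antisymm : ∀ {a b}, le a b → le b a → a = b
  star_star : ∀ a, star (star a) = a
  star_antitone : ∀ {a b}, le a b → le (star b) (star a)
  ne_star : ∀ a, a ≠ star a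
  not_le_star : ∀ a, ¬ le a (star a)
  not_star_le : ∀ a, ¬ le (star a) a

namespace Pocset

variable {P : Type u} {P' : Type v}

/-- Strict order. -/
def lt (Q : Pocset P) (a b : P) : Prop := Q.le a b ∧ a ≠ b

/-- The orientations of the hyperplane `ĥ` determined by the halfspace `h`. -/
def orient (Q : Pocset P) (h : P) : Set P := {h, Q.star h}

/-- `k` is an orientation of the same hyperplane as `h`, i.e. `k̂ = ĥ`. -/
def sameHyp (Q : Pocset P) (h k : P) : Prop := k = h ∨ k = Q.star h

/-- The hyperplanes `ĥ` and `k̂` are transverse: they are distinct and no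
orientation of `ĥ` is comparable with any orientation of `k̂`. -/
def transverse (Q : Pocset P) (h k : P) : Prop :=
  ¬ Q.sameHyp h k ∧ ∀ a ∈ Q.orient h, ∀ b ∈ Q.orient k, ¬ Q.le a b ∧ ¬ Q.le b a

/-- Two hyperplanes are disjoint if they are distinct and not transverse. -/
def disjointHyp (Q : Pocset P) (h k : P) : Prop :=
  ¬ Q.sameHyp h k ∧ ¬ Q.transverse h k

/-- The halfspaces `h` and `k` are facing: `h* < k`. -/
def facing (Q : Pocset P) (h k : P) : Prop := Q.lt (Q.star h) k

/-- The halfspaces `h` and `k` are compatible: not `k ≤ h*`. -/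
def compatible (Q : Pocset P) (h k : P) : Prop := ¬ Q.le k (Q.star h)

/-- The hyperplane `k̂` separates the hyperplanes `ĥ` and `l̂`: there are
orientations with `a < b < c`. -/
def separates (Q : Pocset P) (k h l : P) : Prop :=
  ∃ a ∈ Q.orient h, ∃ b ∈ Q.orient k, ∃ c ∈ Q.orient l, Q.lt a b ∧ Q.lt b c

/-- Local finiteness: every interval is finite. -/
def LocallyFinite (Q : Pocset P) : Prop :=
  ∀ a b : P, {c : P | Q.le a c ∧ Q.le c b}.Finite

/-- The equivalence relation induced on hyperplanes by a relation `r` on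
halfspaces: `ĥ ∼ k̂` iff `h ∼ k` or `h ∼ k*`. -/
def hypRel (Q : Pocset P) (r : P → P → Prop) (h k : P) : Prop :=
  r h k ∨ r h (Q.star k)

/-- An admissible equivalence relation on a pocset. -/
structure IsAdmissible (Q : Pocset P) (r : P → P → Prop) : Prop where
  equiv : Equivalence r
  aer1 : ∀ h, ¬ r h (Q.star h)
  aer2 : ∀ h k, r h k → r (Q.star h) (Q.star k)
  aer3 : ∀ h k, Q.transverse h k → ¬ r h k
  aer4 : ∀ h k, Q.hypRel r h k → ¬ Q.sameHyp h k →
    (∀ m, Q.hypRel r h m → ¬ Q.separates m h k) →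
    ∀ a ∈ Q.orient h, ∀ b ∈ Q.orient k, Q.facing a b → r a b

/-- The strict quotient relation: `[h] < [k]` iff `[h] ≠ [k]`, every pair of
representatives has disjoint hyperplanes, and `h' < k'` for every pair of
representatives whose hyperplanes are `([ĥ] ∪ [k̂])`-inseparable. -/
def QuotLT (Q : Pocset P) (r : P → P → Prop) (h k : P) : Prop :=
  ¬ r h k ∧
  (∀ h' k', r h h' → r k k' → Q.disjointHyp h' k') ∧
  (∀ h' k', r h h' → r k k' →
    (∀ m, (Q.hypRel r h m ∨ Q.hypRel r k m) → ¬ Q.separates m h' k') → Q.lt h' k')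

/-- The quotient relation: `[h] ≤ [k]` iff `[h] = [k]` or `[h] < [k]`. -/
def QuotLE (Q : Pocset P) (r : P → P → Prop) (h k : P) : Prop :=
  r h k ∨ Q.QuotLT r h k

/-- Transversality of `[ĥ]` and `[k̂]` in the quotient pocset. -/
def QuotTransverse (Q : Pocset P) (r : P → P → Prop) (h k : P) : Prop :=
  ¬ Q.hypRel r h k ∧
  ∀ a ∈ Q.orient h, ∀ b ∈ Q.orient k, ¬ Q.QuotLE r a b ∧ ¬ Q.QuotLE r b a

/-- `[k̂]` separates `[ĥ]` and `[l̂]` in the quotient pocset. -/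
def QuotSeparates (Q : Pocset P) (r : P → P → Prop) (k h l : P) : Prop :=
  ∃ a ∈ Q.orient h, ∃ b ∈ Q.orient k, ∃ c ∈ Q.orient l,
    Q.QuotLT r a b ∧ Q.QuotLT r b c

/-- `[h]` and `[k]` are facing in the quotient pocset: `[h]* < [k]`. -/
def QuotFacing (Q : Pocset P) (r : P → P → Prop) (h k : P) : Prop :=
  Q.QuotLT r (Q.star h) k

/-- An admissible map of pocsets. -/
structure IsAdmissibleMap (Q : Pocset P) (Q' : Pocset P') (f : P → P') : Prop where
  am1 : ∀ h, f (Q.star h) = Q'.star (f h)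
  am2 : ∀ h k, Q.transverse h k → Q'.transverse (f h) (f k)
  am3 : ∀ h k, Q.facing h k → Q'.sameHyp (f h) (f k) →
    (∀ m, Q'.sameHyp (f m) (f h) → ¬ Q.separates m h k) → f h = f k
  am4 : ∀ h' : P', (∀ m : P, ¬ Q'.sameHyp (f m) h') →
    ∃ b ∈ Q'.orient h', ∀ m : P, Q'.compatible b (f m)

/-- An embedding of pocsets: an injective, order-reflecting admissible map. -/
structure IsPocsetEmbedding (Q : Pocset P) (Q' : Pocset P') (f : P → P') : Prop where
  adm : IsAdmissibleMap Q Q' f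
  inj : Function.Injective f
  le_reflect : ∀ h k, Q'.le (f h) (f k) → Q.le h k

/-- The equivalence relation `∼_f` induced by a map `f`. -/
def simRel (f : P → P') : P → P → Prop := fun a b => f a = f b

/-- A resolution of pocsets: an admissible map `f` such that `∼_f` is an
admissible equivalence relation and the induced map `P/∼_f → P'` is an
embedding of pocsets (stated here on representatives: `quot_am2` and
`quot_am3` are admissibility of the induced map, `le_reflect` is
order-reflection; injectivity of the induced map is automatic, and its
properties (AM1) and (AM4) coincide with those of `f`). -/
structure IsResolution (Q : Pocset P) (Q' : Pocset P') (f : P → P') : Prop where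
  adm : IsAdmissibleMap Q Q' f
  aer : Q.IsAdmissible (simRel f)
  quot_am2 : ∀ h k, Q.QuotTransverse (simRel f) h k → Q'.transverse (f h) (f k)
  quot_am3 : ∀ h k, Q.QuotFacing (simRel f) h k → Q'.sameHyp (f h) (f k) →
    (∀ m, Q'.sameHyp (f m) (f h) → ¬ Q.QuotSeparates (simRel f) m h k) → f h = f k
  le_reflect : ∀ h k, Q'.le (f h) (f k) → Q.QuotLE (simRel f) h k

/-- A group `G` acts (without inversion) on the pocset `Q` by order-preserving
bijections commuting with `star`. -/
structure IsGAction (Q : Pocset P) (G : Type w) [Group G] [MulAction G P] : Prop where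
  smul_le : ∀ (g : G) (a b : P), Q.le a b → Q.le (g • a) (g • b)
  smul_star : ∀ (g : G) (a : P), g • Q.star a = Q.star (g • a)
  no_inversion : ∀ (g : G) (a : P), g • a ≠ Q.star a

/-- `G`-equivariance of a map. -/
def Equivariant (G : Type w) [Group G] [MulAction G P] [MulAction G P']
    (f : P → P') : Prop :=
  ∀ (g : G) (a : P), f (g • a) = g • f a

/-- An elementary foldable pair for a resolution `f`: facing halfspaces with
`f h₁ = f h₂`, whose hyperplanes are `f⁻¹(f(ĥ₁))`-inseparable, such that no
pair of distinct `∼_f`-equivalent hyperplanes both separate `ĥ₁` and `ĥ₂`. -/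
def ElemFoldable (Q : Pocset P) (Q' : Pocset P') (f : P → P') (h₁ h₂ : P) : Prop :=
  Q.facing h₁ h₂ ∧ f h₁ = f h₂ ∧
  (∀ m, Q'.sameHyp (f m) (f h₁) → ¬ Q.separates m h₁ h₂) ∧
  (∀ m m', Q'.sameHyp (f m) (f m') → ¬ Q.sameHyp m m' →
    ¬ (Q.separates m h₁ h₂ ∧ Q.separates m' h₁ h₂))

/-- `r` is the smallest `G`-invariant and `star`-invariant equivalence
relation with `h₁ ∼ h₂`. -/
structure IsFoldRel (Q : Pocset P) (G : Type w) [Group G] [MulAction G P]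
    (h₁ h₂ : P) (r : P → P → Prop) : Prop where
  equiv : Equivalence r
  ginv : ∀ (g : G) (a b : P), r a b → r (g • a) (g • b)
  sinv : ∀ a b, r a b → r (Q.star a) (Q.star b)
  base : r h₁ h₂
  min : ∀ s : P → P → Prop, Equivalence s →
    (∀ (g : G) (a b : P), s a b → s (g • a) (g • b)) →
    (∀ a b, s a b → s (Q.star a) (Q.star b)) → s h₁ h₂ →
    ∀ a b, r a b → s a b

/-- `[h₁]`, `[h₂]` is an elementary foldable pair in the quotient pocset
`P/r` for the resolution induced by `f` on `P/r`. -/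
def QuotElemFoldable (Q : Pocset P) (Q' : Pocset P') (f : P → P')
    (r : P → P → Prop) (h₁ h₂ : P) : Prop :=
  Q.QuotFacing r h₁ h₂ ∧ f h₁ = f h₂ ∧
  (∀ m, Q'.sameHyp (f m) (f h₁) → ¬ Q.QuotSeparates r m h₁ h₂) ∧
  (∀ m m', Q'.sameHyp (f m) (f m') → ¬ Q.hypRel r m m' →
    ¬ (Q.QuotSeparates r m h₁ h₂ ∧ Q.QuotSeparates r m' h₁ h₂))

/-- `r'` is (the pullback to `P` of) the smallest `G`-invariant and
`star`-invariant equivalence relation on `P/r` identifying `[h₁] ∼ [h₂]`,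
i.e. the smallest `G`-invariant, `star`-invariant equivalence relation on `P`
containing `r` with `h₁ ∼ h₂`. -/
structure IsFoldStepRel (Q : Pocset P) (G : Type w) [Group G] [MulAction G P]
    (r : P → P → Prop) (h₁ h₂ : P) (r' : P → P → Prop) : Prop where
  equiv : Equivalence r'
  mono : ∀ a b, r a b → r' a b
  ginv : ∀ (g : G) (a b : P), r' a b → r' (g • a) (g • b)
  sinv : ∀ a b, r' a b → r' (Q.star a) (Q.star b)
  base : r' h₁ h₂
  min : ∀ s : P → P → Prop, Equivalence s → (∀ a b, r a b → s a b) →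
    (∀ (g : G) (a b : P), s a b → s (g • a) (g • b)) →
    (∀ a b, s a b → s (Q.star a) (Q.star b)) → s h₁ h₂ →
    ∀ a b, r' a b → s a b

/-- A finite folding sequence `P = P₀ ↝ P₁ ↝ ⋯ ↝ Pₙ` for a `G`-equivariant
resolution `f : P → P'`, encoded by the sequence of equivalence relations
`rs i` on `P` with `Pᵢ = P / rs i`: `rs 0` is equality, every `rs i` refines
`∼_f`, and each step is an elementary fold (of an elementary foldable pair
for the induced resolution `fᵢ : P/rs i → P'`). -/
def IsFoldingSequence (Q : Pocset P) (Q' : Pocset P') (G : Type w) [Group G]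
    [MulAction G P] (f : P → P') (n : ℕ)
    (rs : Fin (n + 1) → (P → P → Prop)) : Prop :=
  (∀ a b : P, rs 0 a b ↔ a = b) ∧
  (∀ (i : Fin (n + 1)) (a b : P), rs i a b → f a = f b) ∧
  (∀ i : Fin n, ∃ h₁ h₂ : P,
    Q.QuotElemFoldable Q' f (rs i.castSucc) h₁ h₂ ∧
    Q.IsFoldStepRel G (rs i.castSucc) h₁ h₂ (rs i.succ))

end Pocset

namespace Pocset

section Basic

variable {P : Type u} {Q : Pocset P} {a b c h k l m x y : P} {r : P → P → Prop}

theorem lt.trans (hab : Q.lt a b) (hbc : Q.lt b c) : Q.lt a c := by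
  refine ⟨Q.le_trans hab.1 hbc.1, ?_⟩
  rintro rfl
  exact hab.2 (Q.le_antisymm hab.1 hbc.1)

theorem lt.star (hab : Q.lt a b) : Q.lt (Q.star b) (Q.star a) := by
  refine ⟨Q.star_antitone hab.1, fun h => hab.2 ?_⟩
  rw [← Q.star_star a, ← h, Q.star_star]

theorem lt_irrefl (a : P) : ¬ Q.lt a a := fun h => h.2 rfl

theorem lt_star_comm : Q.lt a (Q.star b) ↔ Q.lt b (Q.star a) := by
  constructor <;> intro h <;> simpa [Q.star_star] using h.star

theorem star_lt_comm : Q.lt (Q.star a) b ↔ Q.lt (Q.star b) a := by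
  constructor <;> intro h <;> simpa [Q.star_star] using h.star

theorem star_lt_star : Q.lt (Q.star a) (Q.star b) ↔ Q.lt b a := by
  constructor <;> intro h <;> simpa [Q.star_star] using h.star

/-- No halfspace is contained in both orientations of a hyperplane. -/
theorem lt.not_lt_star (hab : Q.lt a b) : ¬ Q.lt a (Q.star b) := fun h =>
  Q.not_le_star a (hab.trans (lt_star_comm.1 h)).1

/-- No halfspace contains both orientations of a hyperplane. -/
theorem lt.not_star_lt (hab : Q.lt a b) : ¬ Q.lt (Q.star a) b := fun h =>
  Q.not_star_le b ((star_lt_comm.1 h).trans hab).1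

theorem self_mem_orient (h : P) : h ∈ Q.orient h := Or.inl rfl

theorem star_mem_orient (h : P) : Q.star h ∈ Q.orient h := Or.inr rfl

theorem orient_star (h : P) : Q.orient (Q.star h) = Q.orient h := by
  simp [orient, Q.star_star, Set.pair_comm]

theorem orient_eq (ha : a ∈ Q.orient h) : Q.orient a = Q.orient h := by
  rcases ha with rfl | rfl
  exacts [rfl, orient_star h]

/-- The hyperplane of `x` lies on the side `b` of the hyperplane of `b`. -/
def OnSide (Q : Pocset P) (x b : P) : Prop := Q.lt x b ∨ Q.lt (Q.star x) b

theorem onSide_star_left : Q.OnSide (Q.star x) b ↔ Q.OnSide x b := by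
  simp [OnSide, Q.star_star, or_comm]

theorem OnSide.not_star (h : Q.OnSide x b) : ¬ Q.OnSide x (Q.star b) := by
  rintro (h' | h') <;> rcases h with h | h
  · exact h.not_lt_star h'
  · exact lt_irrefl _ (h.trans (lt_star_comm.1 h'))
  · exact lt_irrefl _ (h.trans (star_lt_star.1 h'))
  · exact h.not_lt_star h'

theorem OnSide.of_disjoint (h : Q.disjointHyp x b) :
    Q.OnSide x b ∨ Q.OnSide x (Q.star b) := by
  obtain ⟨hs, ht⟩ := h
  by_contra hcon
  simp only [OnSide, not_or] at hcon
  obtain ⟨⟨h1, h2⟩, h3, h4⟩ := hcon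
  have key : ∀ y ∈ Q.orient x, ∀ c ∈ Q.orient b, ¬ Q.le y c := by
    intro y hy c hc hle
    have hne : y ≠ c := by
      rintro rfl
      apply hs
      rcases hy with rfl | rfl <;> rcases hc with hc | hc
      · exact Or.inl hc.symm
      · exact Or.inr (by rw [hc, Q.star_star])
      · exact Or.inr hc.symm
      · exact Or.inl (by rw [← Q.star_star b, ← hc, Q.star_star])
    have hlt : Q.lt y c := ⟨hle, hne⟩
    rcases hy with rfl | rfl <;> rcases hc with rfl | rfl <;> contradiction
  refine ht ⟨hs, fun y hy c hc => ⟨key y hy c hc, fun hle => ?_⟩⟩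
  refine key (Q.star y) ?_ (Q.star c) ?_ (Q.star_antitone hle)
  · rw [← orient_eq hy]; exact star_mem_orient y
  · rw [← orient_eq hc]; exact star_mem_orient c

theorem separates_congr {k' h' l' : P} (hk : Q.orient k = Q.orient k')
    (hh : Q.orient h = Q.orient h') (hl : Q.orient l = Q.orient l') :
    Q.separates k h l ↔ Q.separates k' h' l' := by
  simp only [separates, hk, hh, hl]

theorem separates_iff :
    Q.separates m x y ↔
      Q.OnSide x m ∧ Q.OnSide y (Q.star m) ∨ Q.OnSide x (Q.star m) ∧ Q.OnSide y m := by
  constructor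
  · rintro ⟨a, ha, b, hb, c, hc, hab, hbc⟩
    have h1 : Q.OnSide x b := by
      rcases ha with rfl | rfl
      exacts [Or.inl hab, Or.inr hab]
    have h2 : Q.OnSide y (Q.star b) := by
      rcases hc with rfl | rfl
      · exact Or.inr hbc.star
      · exact Or.inl (lt_star_comm.1 hbc)
    rcases hb with rfl | rfl
    · exact Or.inl ⟨h1, h2⟩
    · exact Or.inr ⟨h1, by rwa [Q.star_star] at h2⟩
  · have key : ∀ n ∈ Q.orient m, Q.OnSide x n → Q.OnSide y (Q.star n) →
        Q.separates m x y := by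
      intro n hn h1 h2
      have h2' : ∃ c ∈ Q.orient y, Q.lt n c := by
        rcases h2 with h2 | h2
        · exact ⟨_, star_mem_orient y, lt_star_comm.1 h2⟩
        · exact ⟨_, self_mem_orient y, star_lt_star.1 h2⟩
      obtain ⟨c, hc, hnc⟩ := h2'
      rcases h1 with h1 | h1
      · exact ⟨_, self_mem_orient x, n, hn, c, hc, h1, hnc⟩
      · exact ⟨_, star_mem_orient x, n, hn, c, hc, h1, hnc⟩
    rintro (⟨h1, h2⟩ | ⟨h1, h2⟩)
    · exact key m (self_mem_orient m) h1 h2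
    · exact key _ (star_mem_orient m) h1 (by rwa [Q.star_star])

theorem sameHyp_iff : Q.sameHyp x y ↔ Q.orient x = Q.orient y :=
  ⟨fun h => (orient_eq h).symm, fun h => show y ∈ Q.orient x from h ▸ self_mem_orient y⟩

theorem transverse_congr {x' y' : P} (hx : Q.orient x = Q.orient x')
    (hy : Q.orient y = Q.orient y') : Q.transverse x y ↔ Q.transverse x' y' := by
  simp only [transverse, sameHyp_iff, hx, hy]

theorem transverse_symm (h : Q.transverse x y) : Q.transverse y x :=
  ⟨fun h' => h.1 (sameHyp_iff.2 (sameHyp_iff.1 h').symm),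
    fun a ha b hb => (h.2 b hb a ha).symm⟩

theorem not_transverse_of_orient_eq (h : Q.orient x = Q.orient y) : ¬ Q.transverse x y :=
  fun h' => h'.1 (sameHyp_iff.2 h)

theorem separates_symm (h : Q.separates m x y) : Q.separates m y x := by
  rw [separates_iff] at h ⊢
  tauto

theorem separates_of_lt (h1 : Q.lt x m) (h2 : Q.lt m y) : Q.separates m x y :=
  ⟨x, self_mem_orient x, m, self_mem_orient m, y, self_mem_orient y, h1, h2⟩

/-- If `x < y`, a hyperplane separating `x̂` and `ŷ` has an orientation between `x` and `y`. -/
theorem separates.exists_between (hxy : Q.lt x y) (h : Q.separates m x y) :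
    ∃ n ∈ Q.orient m, Q.lt x n ∧ Q.lt n y := by
  obtain ⟨a, ha, n, hn, c, hc, h1, h2⟩ := h
  have h3 := h1.trans h2
  refine ⟨n, hn, ?_⟩
  rcases ha with rfl | rfl <;> rcases hc with rfl | rfl
  · exact ⟨h1, h2⟩
  · exact absurd h3 hxy.not_lt_star
  · exact absurd h3 hxy.not_star_lt
  · exact absurd (hxy.trans (star_lt_star.1 h3)) (lt_irrefl _)

theorem hypRel_comm (he : Equivalence r) (hs : ∀ a b, r a b → r (Q.star a) (Q.star b))
    (h : Q.hypRel r x y) : Q.hypRel r y x := by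
  rcases h with h | h
  · exact Or.inl (he.symm h)
  · exact Or.inr (he.symm (by simpa [Q.star_star] using hs _ _ h))

theorem hypRel_congr (hs : ∀ a b, r a b → r (Q.star a) (Q.star b))
    (ha : a ∈ Q.orient x) (hb : b ∈ Q.orient y) : Q.hypRel r a b ↔ Q.hypRel r x y := by
  have hs' : ∀ c d, r (Q.star c) d ↔ r c (Q.star d) := fun c d =>
    ⟨fun h => by simpa [Q.star_star] using hs _ _ h,
      fun h => by simpa [Q.star_star] using hs _ _ h⟩
  rcases ha with rfl | rfl <;> rcases hb with rfl | rfl <;>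
    simp [hypRel, hs', Q.star_star, or_comm]

end Basic

/-- The properties of the equivalence relation `r` of an elementary fold, relative to a
nested family `S` of halfspaces: distinct equivalent halfspaces are facing in the
orientation singled out by `O`, and are not separated by hyperplanes of `S`. -/
structure IsNestedFold {P : Type u} (Q : Pocset P) (r : P → P → Prop) (O S : P → Prop) :
    Prop where
  equiv : Equivalence r
  star : ∀ {x y}, r x y → r (Q.star x) (Q.star y)
  orient_congr : ∀ {x y}, r x y → O x → O y
  not_orient_star : ∀ {x}, O x → ¬ O (Q.star x)
  facing : ∀ {x y}, r x y →
    x = y ∨ O x ∧ Q.lt (Q.star x) y ∨ O (Q.star x) ∧ Q.lt x (Q.star y)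
  mem_congr : ∀ {x y}, r x y → S x → S y
  mem_star : ∀ {x}, S x → S (Q.star x)
  nested : ∀ {x y}, S x → S y → ¬ Q.transverse x y
  insep : ∀ {x y m}, r x y → S x → S m → ¬ Q.separates m x y

/-- The class of the hyperplane of `x` lies on the side `[b]` of the class of `b`. -/
def ClassOnSide {P : Type u} (Q : Pocset P) (r : P → P → Prop) (O : P → Prop)
    (x b : P) : Prop :=
  (O b ∧ ∀ b', r b b' → Q.OnSide x b') ∨ (¬ O b ∧ ∃ b', r b b' ∧ Q.OnSide x b')

theorem classOnSide_star_left {P : Type u} {Q : Pocset P} {r : P → P → Prop} {O : P → Prop}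
    {x b : P} : Q.ClassOnSide r O (Q.star x) b ↔ Q.ClassOnSide r O x b := by
  simp only [ClassOnSide, onSide_star_left]

namespace IsNestedFold

variable {P : Type u} {Q : Pocset P} {r : P → P → Prop} {O S : P → Prop}
  {a b h k l x y : P}

theorem rel_star_comm (F : Q.IsNestedFold r O S) : r (Q.star x) y ↔ r x (Q.star y) :=
  ⟨fun h => by simpa [Q.star_star] using F.star h,
    fun h => by simpa [Q.star_star] using F.star h⟩

theorem hypRel_star_left (F : Q.IsNestedFold r O S) :
    Q.hypRel r (Q.star x) y ↔ Q.hypRel r x y :=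
  hypRel_congr (fun _ _ => F.star) (star_mem_orient x) (self_mem_orient y)

theorem hypRel_star_right (F : Q.IsNestedFold r O S) :
    Q.hypRel r x (Q.star y) ↔ Q.hypRel r x y :=
  hypRel_congr (fun _ _ => F.star) (self_mem_orient x) (star_mem_orient y)

theorem hypRel_comm (F : Q.IsNestedFold r O S) : Q.hypRel r x y ↔ Q.hypRel r y x :=
  ⟨Pocset.hypRel_comm F.equiv fun _ _ => F.star,
    Pocset.hypRel_comm F.equiv fun _ _ => F.star⟩

theorem disjointHyp (F : Q.IsNestedFold r O S) (hx : S x) (hy : S y)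
    (hxy : ¬ Q.hypRel r x y) {x' y' : P} (hx' : r x x') (hy' : r y y') :
    Q.disjointHyp x' y' := by
  refine ⟨?_, F.nested (F.mem_congr hx' hx) (F.mem_congr hy' hy)⟩
  rintro (rfl | rfl)
  · exact hxy (Or.inl (F.equiv.trans hx' (F.equiv.symm hy')))
  · exact hxy (Or.inr (F.equiv.trans hx' (F.equiv.symm
      (by simpa [Q.star_star] using F.star hy'))))

theorem classOnSide_or (F : Q.IsNestedFold r O S) (hx : S x) (hb : S b)
    (hxb : ¬ Q.hypRel r x b) :
    Q.ClassOnSide r O x b ∨ Q.ClassOnSide r O x (Q.star b) := by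
  have hor : ∀ b', r b b' → Q.OnSide x b' ∨ Q.OnSide x (Q.star b') := fun b' hb' =>
    OnSide.of_disjoint (F.disjointHyp hx hb hxb (F.equiv.refl x) hb')
  by_cases hO : O b
  · by_cases hall : ∀ b', r b b' → Q.OnSide x b'
    · exact Or.inl (Or.inl ⟨hO, hall⟩)
    · push Not at hall
      obtain ⟨b', hb', hn⟩ := hall
      exact Or.inr (Or.inr ⟨F.not_orient_star hO, Q.star b', F.star hb',
        (hor b' hb').resolve_left hn⟩)
  · by_cases hex : ∃ b', r b b' ∧ Q.OnSide x b'
    · exact Or.inl (Or.inr ⟨hO, hex⟩)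
    · push Not at hex
      have hall : ∀ b', r (Q.star b) b' → Q.OnSide x b' := fun b' hb' => by
        have hb'' := F.rel_star_comm.1 hb'
        simpa [Q.star_star] using (hor _ hb'').resolve_left (hex _ hb'')
      by_cases hO' : O (Q.star b)
      · exact Or.inr (Or.inl ⟨hO', hall⟩)
      · exact Or.inr (Or.inr ⟨hO', Q.star b, F.equiv.refl _, hall _ (F.equiv.refl _)⟩)

/-- A class whose members do not separate `x̂` and `ŷ` has them on the same side. -/
theorem classOnSide_of_not_separates (F : Q.IsNestedFold r O S) (hy : S y) (hb : S b)
    (hyb : ¬ Q.hypRel r y b) (hsep : ∀ b', r b b' → ¬ Q.separates b' x y)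
    (h : Q.ClassOnSide r O x b) : Q.ClassOnSide r O y b := by
  have key : ∀ b', r b b' → Q.OnSide x b' → Q.OnSide y b' := fun b' hb' hxb' => by
    refine (OnSide.of_disjoint
      (F.disjointHyp hy hb hyb (F.equiv.refl y) hb')).resolve_right fun hn => ?_
    exact hsep b' hb' (separates_iff.2 (Or.inl ⟨hxb', hn⟩))
  rcases h with ⟨hO, hall⟩ | ⟨hO, b', hb', hx'⟩
  · exact Or.inl ⟨hO, fun b' hb' => key b' hb' (hall b' hb')⟩
  · exact Or.inr ⟨hO, b', hb', key b' hb' hx'⟩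

theorem onSide_of_classOnSide (F : Q.IsNestedFold r O S) (hx : S x) (hb : S b)
    (hxb : ¬ Q.hypRel r x b) (h : Q.ClassOnSide r O x b) {x' b' : P} (hx' : r x x')
    (hb' : r b b') (hsep : ∀ m, r b m → ¬ Q.separates m x' b') : Q.OnSide x' b' := by
  have hx'b : ¬ Q.hypRel r x' b := fun hr => hxb <| hr.imp
    (fun hr => F.equiv.trans hx' hr) (fun hr => F.equiv.trans hx' hr)
  have hSx' := F.mem_congr hx' hx
  have h' : Q.ClassOnSide r O x' b := F.classOnSide_of_not_separates hSx' hb hx'b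
    (fun b' hb' => F.insep hx' hx (F.mem_congr hb' hb)) h
  rcases h' with ⟨-, hall⟩ | ⟨hO, b'', hb'', hside⟩
  · exact hall b' hb'
  · have hrel : r b' b'' := F.equiv.trans (F.equiv.symm hb') hb''
    rcases F.facing hrel with rfl | ⟨hO', -⟩ | ⟨-, hlt⟩
    · exact hside
    · exact absurd (F.orient_congr (F.equiv.symm hb') hO') hO
    · exact absurd (separates_iff.2 (Or.inl ⟨hside, Or.inl hlt⟩)) (hsep b'' hb'')

theorem quotLT (F : Q.IsNestedFold r O S) (ha : S a) (hb : S b) (hab : ¬ Q.hypRel r a b)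
    (h1 : Q.ClassOnSide r O a b) (h2 : Q.ClassOnSide r O b (Q.star a)) :
    Q.QuotLT r a b := by
  refine ⟨fun h => hab (Or.inl h), fun a' b' ha' hb' => F.disjointHyp ha hb hab ha' hb',
    fun a' b' ha' hb' hsep => ?_⟩
  have h3 : Q.OnSide a' b' := F.onSide_of_classOnSide ha hb hab h1 ha' hb'
    fun m hm => hsep m (Or.inr (Or.inl hm))
  have h4 : Q.OnSide b' (Q.star a') := by
    refine F.onSide_of_classOnSide hb (F.mem_star ha)
      (by rwa [F.hypRel_star_right, F.hypRel_comm]) h2 hb' (F.star ha') fun m hm hs => ?_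
    refine hsep m (Or.inl (Or.inr (F.rel_star_comm.1 hm))) (separates_symm ?_)
    exact (separates_congr rfl rfl (orient_star a')).1 hs
  rcases h3 with h3 | h3
  · exact h3
  · rcases h4 with h4 | h4
    · exact absurd (h3.trans h4) (lt_irrefl _)
    · exact star_lt_star.1 h4

theorem quotFacing (F : Q.IsNestedFold r O S) (ha : S a) (hb : S b)
    (hab : ¬ Q.hypRel r a b) (h1 : Q.ClassOnSide r O a b) (h2 : Q.ClassOnSide r O b a) :
    Q.QuotFacing r a b :=
  F.quotLT (F.mem_star ha) hb (by rwa [F.hypRel_star_left])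
    (classOnSide_star_left.2 h1) (by rwa [Q.star_star])

/-- If `h < k < l` but `[l̂]` lies on the side `[k]` of `[k̂]`, then exactly two hyperplanes
of the class of `k̂` separate `ĥ` and `l̂`. -/
theorem exists_two_separating (F : Q.IsNestedFold r O S) (hhk : Q.lt h k) (hkl : Q.lt k l)
    (hside : Q.ClassOnSide r O l k) :
    ∃ m₁ m₂ : P, Q.hypRel r k m₁ ∧ Q.hypRel r k m₂ ∧ ¬ Q.sameHyp m₁ m₂ ∧
      Q.separates m₁ h l ∧ Q.separates m₂ h l ∧
      ∀ m : P, Q.hypRel r k m → Q.separates m h l → Q.sameHyp m m₁ ∨ Q.sameHyp m m₂ := by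
  have hlk : Q.OnSide l (Q.star k) := Or.inr hkl.star
  rcases hside with ⟨-, hall⟩ | ⟨hO, k', hkk', hlk'⟩
  · exact absurd hlk (hall k (F.equiv.refl k)).not_star
  have hO' : O (Q.star k) ∧ Q.lt k (Q.star k') := by
    rcases F.facing hkk' with rfl | ⟨hO', -⟩ | h'
    · exact absurd hlk hlk'.not_star
    · exact absurd hO' hO
    · exact h'
  obtain ⟨hOs, hlt⟩ := hO'
  have hk'l : Q.lt (Q.star k') l := by
    rcases hlk' with h' | h'
    · exact absurd hlt (hkl.trans h').not_lt_star
    · exact star_lt_comm.1 h'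
  refine ⟨k, k', Or.inl (F.equiv.refl k), Or.inl hkk', ?_, separates_of_lt hhk hkl,
    (separates_congr (orient_star k') rfl rfl).1 (separates_of_lt (hhk.trans hlt) hk'l), ?_⟩
  · rintro (rfl | rfl)
    · exact Q.not_le_star _ hlt.1
    · exact lt_irrefl _ (by simpa [Q.star_star] using hlt)
  · have key : ∀ n, r k n → Q.separates n h l → n = k ∨ n = k' := by
      intro n hn hs
      rcases F.facing hn with h' | ⟨h', -⟩ | ⟨-, hkn⟩
      · exact Or.inl h'.symm
      · exact absurd h' hO
      rcases F.facing (F.equiv.trans (F.equiv.symm hkk') hn) with h' | ⟨h', -⟩ | ⟨-, hkn'⟩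
      · exact Or.inr h'.symm
      · exact absurd (F.orient_congr (F.equiv.symm hkk') h') hO
      obtain ⟨n', hn', h1, h2⟩ := hs.exists_between (hhk.trans hkl)
      rcases hn' with rfl | rfl
      · exact absurd (hhk.trans hkn) h1.not_lt_star
      · exact absurd (hkn'.trans h2) fun h' => hk'l.not_star_lt (by rwa [Q.star_star])
    rintro m (hm | hm) hs
    · rcases key m hm hs with rfl | rfl
      · exact Or.inl (Or.inl rfl)
      · exact Or.inr (Or.inl rfl)
    · rcases key _ hm ((separates_congr (orient_star m) rfl rfl).2 hs) with h' | h'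
      · exact Or.inl (Or.inr h'.symm)
      · exact Or.inr (Or.inr h'.symm)

theorem exists_classOnSide_both (F : Q.IsNestedFold r O S) (hh : S h) (hk : S k) (hl : S l)
    (hkh : ¬ Q.hypRel r k h) (hlh : ¬ Q.hypRel r l h)
    (hsep : ∀ h', r h h' → ¬ Q.separates h' k l) :
    ∃ a ∈ Q.orient h, Q.ClassOnSide r O k a ∧ Q.ClassOnSide r O l a := by
  rcases F.classOnSide_or hk hh hkh with h' | h'
  · exact ⟨h, self_mem_orient h, h', F.classOnSide_of_not_separates hl hh hlh hsep h'⟩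
  · refine ⟨_, star_mem_orient h, h', F.classOnSide_of_not_separates hl (F.mem_star hh)
      (by rwa [F.hypRel_star_right]) (fun b hb hs => ?_) h'⟩
    exact hsep _ (F.rel_star_comm.1 hb) ((separates_congr (orient_star b) rfl rfl).2 hs)

/-- The trichotomy for `h < k < l` after a fold. -/
theorem trichotomy (F : Q.IsNestedFold r O S) (hh : S h) (hk : S k) (hl : S l)
    (hhk : Q.lt h k) (hkl : Q.lt k l) (hq : ¬ Q.QuotSeparates r k h l) :
    Q.hypRel r h k ∨ Q.hypRel r l k ∨
    ((∃ a ∈ Q.orient h, ∃ b ∈ Q.orient k, ∃ c ∈ Q.orient l,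
        Q.QuotFacing r a b ∧ Q.QuotFacing r b c ∧ Q.QuotFacing r a c) ∧
      (∃ m₁ m₂ : P, Q.hypRel r k m₁ ∧ Q.hypRel r k m₂ ∧ ¬ Q.sameHyp m₁ m₂ ∧
        Q.separates m₁ h l ∧ Q.separates m₂ h l ∧
        ∀ m : P, Q.hypRel r k m → Q.separates m h l →
          Q.sameHyp m m₁ ∨ Q.sameHyp m m₂)) := by
  by_cases nhk : Q.hypRel r h k
  · exact Or.inl nhk
  by_cases nlk : Q.hypRel r l k
  · exact Or.inr (Or.inl nlk)
  refine Or.inr (Or.inr ?_)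
  have nhl : ¬ Q.hypRel r h l := by
    rintro (h' | h')
    · exact F.insep h' hh hk (separates_of_lt hhk hkl)
    · exact F.insep h' hh hk
        ((separates_congr rfl rfl (orient_star l)).2 (separates_of_lt hhk hkl))
  have nlh := mt F.hypRel_comm.1 nhl
  have nkh := mt F.hypRel_comm.1 nhk
  have nkl := mt F.hypRel_comm.1 nlk
  obtain ⟨a, ha, hka, hla⟩ := F.exists_classOnSide_both hh hk hl nkh nlh fun h' hr hs => by
    obtain ⟨n, hn, h1, -⟩ := hs.exists_between hkl
    exact F.insep hr hh hk
      ((separates_congr rfl rfl (orient_eq hn)).1 (separates_of_lt hhk h1))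
  obtain ⟨c, hc, hkc, hhc⟩ := F.exists_classOnSide_both hl hk hh nkl nhl fun l' hr hs => by
    obtain ⟨n, hn, -, h2⟩ := (separates_symm hs).exists_between hhk
    exact F.insep hr hl hk
      (separates_symm ((separates_congr rfl (orient_eq hn) rfl).1 (separates_of_lt h2 hkl)))
  have hSa : S a := by
    rcases ha with rfl | rfl
    exacts [hh, F.mem_star hh]
  have hSc : S c := by
    rcases hc with rfl | rfl
    exacts [hl, F.mem_star hl]
  have left : ∀ {b}, Q.ClassOnSide r O h b → Q.ClassOnSide r O a b := fun h' => by
    rcases ha with rfl | rfl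
    exacts [h', classOnSide_star_left.2 h']
  have right : ∀ {b}, Q.ClassOnSide r O l b → Q.ClassOnSide r O c b := fun h' => by
    rcases hc with rfl | rfl
    exacts [h', classOnSide_star_left.2 h']
  have hcongr : ∀ {x y x' y'}, x ∈ Q.orient x' → y ∈ Q.orient y' →
      (Q.hypRel r x y ↔ Q.hypRel r x' y') := fun hx hy =>
    hypRel_congr (fun _ _ => F.star) hx hy
  have hka' : ∀ {b}, b ∈ Q.orient k → Q.ClassOnSide r O b a := fun hb => by
    rcases hb with rfl | rfl
    exacts [hka, classOnSide_star_left.2 hka]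
  have hkc' : ∀ {b}, b ∈ Q.orient k → Q.ClassOnSide r O b c := fun hb => by
    rcases hb with rfl | rfl
    exacts [hkc, classOnSide_star_left.2 hkc]
  have hSb : ∀ {b}, b ∈ Q.orient k → S b := fun hb => by
    rcases hb with rfl | rfl
    exacts [hk, F.mem_star hk]
  have opposite : ∀ b ∈ Q.orient k, Q.ClassOnSide r O h b →
      ¬ Q.ClassOnSide r O l (Q.star b) := fun b hb h1 h2 => by
    refine hq ⟨Q.star a, orient_eq ha ▸ star_mem_orient a, b, hb, c, hc, ?_, ?_⟩
    · exact F.quotFacing hSa (hSb hb) (mt (hcongr ha hb).1 nhk) (left h1) (hka' hb)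
    · exact F.quotLT (hSb hb) hSc (mt (hcongr hb hc).1 nkl) (hkc' hb) (right h2)
  have facing : ∀ b ∈ Q.orient k, Q.ClassOnSide r O h b → Q.ClassOnSide r O l b →
      ∃ a ∈ Q.orient h, ∃ b ∈ Q.orient k, ∃ c ∈ Q.orient l,
        Q.QuotFacing r a b ∧ Q.QuotFacing r b c ∧ Q.QuotFacing r a c := fun b hb h1 h2 =>
    ⟨a, ha, b, hb, c, hc,
      F.quotFacing hSa (hSb hb) (mt (hcongr ha hb).1 nhk) (left h1) (hka' hb),
      F.quotFacing (hSb hb) hSc (mt (hcongr hb hc).1 nkl) (hkc' hb) (right h2),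
      F.quotFacing hSa hSc (mt (hcongr ha hc).1 nhl) (left hhc) (right hla)⟩
  rcases F.classOnSide_or hh hk nhk with h1 | h1
  · have h2 := (F.classOnSide_or hl hk nlk).resolve_right
      (opposite k (self_mem_orient k) h1)
    exact ⟨facing k (self_mem_orient k) h1 h2, F.exists_two_separating hhk hkl h2⟩
  · have h2 := (F.classOnSide_or hl hk nlk).resolve_left fun h2 =>
      opposite _ (star_mem_orient k) h1 (by rwa [Q.star_star])
    refine ⟨facing _ (star_mem_orient k) h1 h2, ?_⟩
    obtain ⟨m₁, m₂, r₁, r₂, hne, s₁, s₂, huniq⟩ :=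
      F.exists_two_separating hkl.star hhk.star (classOnSide_star_left.2 h1)
    have swap : ∀ {m}, Q.separates m (Q.star l) (Q.star h) ↔ Q.separates m h l := fun {m} =>
      (separates_congr rfl (orient_star l) (orient_star h)).trans
        ⟨separates_symm, separates_symm⟩
    exact ⟨m₁, m₂, F.hypRel_star_left.1 r₁, F.hypRel_star_left.1 r₂, hne, swap.1 s₁,
      swap.1 s₂, fun m hm hs => huniq m (F.hypRel_star_left.2 hm) (swap.2 hs)⟩

end IsNestedFold

section Action

variable {P : Type u} {Q : Pocset P} {G : Type w} [Group G] [MulAction G P] {m x y : P}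

theorem IsGAction.smul_lt (hG : Q.IsGAction G) (g : G) (h : Q.lt x y) :
    Q.lt (g • x) (g • y) :=
  ⟨hG.smul_le g x y h.1, fun h' => h.2 (MulAction.injective g h')⟩

theorem IsGAction.smul_mem_orient (hG : Q.IsGAction G) (g : G) (h : x ∈ Q.orient y) :
    g • x ∈ Q.orient (g • y) := by
  rcases h with rfl | rfl
  · exact self_mem_orient _
  · rw [hG.smul_star]; exact star_mem_orient _

theorem IsGAction.smul_separates (hG : Q.IsGAction G) (g : G) (h : Q.separates m x y) :
    Q.separates (g • m) (g • x) (g • y) := by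
  obtain ⟨a, ha, b, hb, c, hc, h1, h2⟩ := h
  exact ⟨_, hG.smul_mem_orient g ha, _, hG.smul_mem_orient g hb, _,
    hG.smul_mem_orient g hc, hG.smul_lt g h1, hG.smul_lt g h2⟩

theorem IsGAction.smul_transverse (hG : Q.IsGAction G) (g : G) (h : Q.transverse x y) :
    Q.transverse (g • x) (g • y) := by
  refine ⟨fun h' => h.1 ?_, fun a ha b hb => ?_⟩
  · have := hG.smul_mem_orient g⁻¹ (show g • y ∈ Q.orient (g • x) from h')
    rwa [inv_smul_smul, inv_smul_smul] at this
  · have ha' := hG.smul_mem_orient g⁻¹ ha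
    have hb' := hG.smul_mem_orient g⁻¹ hb
    rw [inv_smul_smul] at ha' hb'
    obtain ⟨h1, h2⟩ := h.2 _ ha' _ hb'
    exact ⟨fun h' => h1 (hG.smul_le g⁻¹ _ _ h'), fun h' => h2 (hG.smul_le g⁻¹ _ _ h')⟩

end Action

section Fold

variable {P : Type u} {P' : Type v} {Q : Pocset P} {Q' : Pocset P'} {f : P → P'}
  {h₁ h₂ x y z m : P}

theorem IsAdmissibleMap.orient_eq (hf : IsAdmissibleMap Q Q' f) (h : x ∈ Q.orient y) :
    Q'.orient (f x) = Q'.orient (f y) := by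
  rcases h with rfl | rfl
  · rfl
  · rw [hf.am1, orient_star]

theorem IsAdmissibleMap.hypRel_simRel (hf : IsAdmissibleMap Q Q' f) :
    Q.hypRel (simRel f) x y ↔ Q'.orient (f x) = Q'.orient (f y) := by
  rw [eq_comm, ← sameHyp_iff, hypRel, simRel, simRel, hf.am1]
  rfl

/-- Every hyperplane separating an elementary foldable pair is transverse, after applying
`f`, to the common image of the pair. -/
theorem ElemFoldable.transverse_of_separates (hres : IsResolution Q Q' f)
    (hfold : ElemFoldable Q Q' f h₁ h₂) (hm : Q.separates m h₁ h₂) :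
    Q'.transverse (f m) (f h₁) := by
  obtain ⟨hface, heq, hinsep, hpair⟩ := hfold
  have hf := hres.adm
  have hface' : Q.lt (Q.star h₁) h₂ := hface
  obtain ⟨n, hn, hn1, hn2⟩ :=
    ((separates_congr rfl (orient_star h₁) rfl).2 hm).exists_between hface'
  have between : ∀ q, Q.lt (Q.star h₁) q → Q.lt q h₂ → Q.separates q h₁ h₂ := fun q h1 h2 =>
    (separates_congr rfl (orient_star h₁) rfl).1 (separates_of_lt h1 h2)
  have excl : ∀ p, (Q'.orient (f m) = Q'.orient (f p) ∨ Q'.orient (f h₁) = Q'.orient (f p)) →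
      ∀ q ∈ Q.orient p, Q.lt (Q.star h₁) q → Q.lt q h₂ → Q.orient q = Q.orient n := by
    intro p hp q hq h1 h2
    have hs := between q h1 h2
    have hfq := hf.orient_eq hq
    rcases hp with hp | hp
    · by_contra hne
      exact hpair n q (sameHyp_iff.2 ((hf.orient_eq hn).trans (hp.trans hfq.symm)))
        (fun h => hne (sameHyp_iff.1 h).symm) ⟨between n hn1 hn2, hs⟩
    · exact absurd hs (hinsep q (sameHyp_iff.2 (hfq.trans hp.symm)))
  have insep₁ : ∀ p, (Q'.orient (f m) = Q'.orient (f p) ∨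
      Q'.orient (f h₁) = Q'.orient (f p)) → ¬ Q.separates p n h₁ := by
    intro p hp hs
    obtain ⟨q, hq, h1, h2⟩ := ((separates_congr rfl (orient_star h₁) rfl).2
      (separates_symm hs)).exists_between hn1
    rcases sameHyp_iff.2 (excl p hp q hq h1 (h2.trans hn2)) with rfl | rfl
    · exact lt_irrefl _ h2
    · exact Q.not_le_star _ h2.1
  have insep₂ : ∀ p, (Q'.orient (f m) = Q'.orient (f p) ∨
      Q'.orient (f h₁) = Q'.orient (f p)) → ¬ Q.separates p n h₂ := by
    intro p hp hs
    obtain ⟨q, hq, h1, h2⟩ := hs.exists_between hn2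
    rcases sameHyp_iff.2 (excl p hp q hq (hn1.trans h1) h2) with rfl | rfl
    · exact lt_irrefl _ h1
    · exact Q.not_star_le _ h1.1
  have hne : Q'.orient (f m) ≠ Q'.orient (f h₁) := fun h => hinsep m (sameHyp_iff.2 h) hm
  have key : ∀ a ∈ Q.orient m, ¬ (Q.lt a h₁ ∧ Q.lt a h₂) ∧ ¬ (Q.lt h₁ a ∧ Q.lt h₂ a) := by
    intro a ha
    rw [← orient_eq hn] at ha
    rcases ha with rfl | rfl
    · exact ⟨fun h => h.1.not_star_lt (star_lt_comm.1 hn1),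
        fun h => lt_irrefl _ (h.2.trans hn2)⟩
    · exact ⟨fun h => hn2.not_star_lt h.2,
        fun h => lt_irrefl _ (hn1.trans (lt_star_comm.1 h.1))⟩
  have star_mem : ∀ {a}, a ∈ Q.orient m → Q.star a ∈ Q.orient m := fun ha =>
    orient_eq ha ▸ star_mem_orient _
  have star_eq : f (Q.star h₁) = f (Q.star h₂) := by rw [hf.am1, hf.am1, heq]
  have inseparable : ∀ a ∈ Q.orient m, ∀ p,
      (Q'.orient (f m) = Q'.orient (f p) ∨ Q'.orient (f h₁) = Q'.orient (f p)) →
      ∀ b, b ∈ Q.orient h₁ ∨ b ∈ Q.orient h₂ → ¬ Q.separates p a b := by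
    intro a ha p hp b hb hs
    have han : Q.orient a = Q.orient n := (orient_eq ha).trans (orient_eq hn).symm
    rcases hb with hb | hb
    · exact insep₁ p hp ((separates_congr rfl han (orient_eq hb)).1 hs)
    · exact insep₂ p hp ((separates_congr rfl han (orient_eq hb)).1 hs)
  have lt_right : ∀ a ∈ Q.orient m, ∀ b ∈ Q.orient h₁, Q.QuotLT (simRel f) a b →
      ∀ b', b' ∈ Q.orient h₁ ∨ b' ∈ Q.orient h₂ → f b = f b' → Q.lt a b' := by
    intro a ha b hb hlt b' hb' hfb
    refine hlt.2.2 a b' rfl hfb fun p hp => inseparable a ha p ?_ b' hb'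
    rwa [hf.hypRel_simRel, hf.hypRel_simRel, hf.orient_eq ha, hf.orient_eq hb] at hp
  have lt_left : ∀ a ∈ Q.orient m, ∀ b ∈ Q.orient h₁, Q.QuotLT (simRel f) b a →
      ∀ b', b' ∈ Q.orient h₁ ∨ b' ∈ Q.orient h₂ → f b = f b' → Q.lt b' a := by
    intro a ha b hb hlt b' hb' hfb
    refine hlt.2.2 b' a hfb rfl fun p hp hs =>
      inseparable a ha p ?_ b' hb' (separates_symm hs)
    rwa [hf.hypRel_simRel, hf.hypRel_simRel, hf.orient_eq ha, hf.orient_eq hb,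
      or_comm] at hp
  refine hres.quot_am2 m h₁ ⟨fun h => hne (hf.hypRel_simRel.1 h), fun a ha b hb => ⟨?_, ?_⟩⟩
  · rintro (h | h)
    · exact hne ((hf.orient_eq ha).symm.trans
        ((congrArg Q'.orient (show f a = f b from h)).trans (hf.orient_eq hb)))
    · have h' := lt_right a ha b hb h
      rcases hb with rfl | rfl
      · exact (key a ha).1
          ⟨h' _ (Or.inl (self_mem_orient _)) rfl, h' _ (Or.inr (self_mem_orient _)) heq⟩
      · exact (key _ (star_mem ha)).2
          ⟨lt_star_comm.1 (h' _ (Or.inl (star_mem_orient _)) rfl),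
            lt_star_comm.1 (h' _ (Or.inr (star_mem_orient _)) star_eq)⟩
  · rintro (h | h)
    · exact hne ((hf.orient_eq ha).symm.trans
        ((congrArg Q'.orient (show f b = f a from h).symm).trans (hf.orient_eq hb)))
    · have h' := lt_left a ha b hb h
      rcases hb with rfl | rfl
      · exact (key a ha).2
          ⟨h' _ (Or.inl (self_mem_orient _)) rfl, h' _ (Or.inr (self_mem_orient _)) heq⟩
      · exact (key _ (star_mem ha)).1
          ⟨star_lt_comm.1 (h' _ (Or.inl (star_mem_orient _)) rfl),
            star_lt_comm.1 (h' _ (Or.inr (star_mem_orient _)) star_eq)⟩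

/-- `x` and `y` are facing halfspaces with the same image, and every hyperplane separating
them has image transverse to theirs. -/
def TightFacing (Q : Pocset P) (Q' : Pocset P') (f : P → P') (x y : P) : Prop :=
  f x = f y ∧ Q.lt (Q.star x) y ∧
    ∀ m, Q.separates m x y → Q'.transverse (f m) (f x)

theorem TightFacing.symm (h : TightFacing Q Q' f x y) : TightFacing Q Q' f y x :=
  ⟨h.1.symm, star_lt_comm.1 h.2.1, fun m hm => h.1 ▸ h.2.2 m (separates_symm hm)⟩

theorem TightFacing.trans (hf : IsAdmissibleMap Q Q' f) (hxy : TightFacing Q Q' f x y)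
    (hyz : TightFacing Q Q' f y z) : x = z ∨ TightFacing Q Q' f x z := by
  obtain ⟨fxy, lxy, sxy⟩ := hxy
  obtain ⟨fyz, lyz, syz⟩ := hyz
  have fxz := fxy.trans fyz
  by_cases hne : x = z
  · exact Or.inl hne
  have lxz : Q.lt (Q.star x) z := by
    have hdis : Q.disjointHyp x z := by
      refine ⟨?_, fun h => not_transverse_of_orient_eq (by rw [fxz]) (hf.am2 _ _ h)⟩
      rintro (h | h)
      · exact hne h.symm
      · exact Q'.ne_star (f x) (by rw [← hf.am1, ← h, fxz])
    rcases OnSide.of_disjoint hdis with (h | h) | h | h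
    · refine absurd (syz x ?_) (not_transverse_of_orient_eq (by rw [fxy]))
      exact (separates_congr rfl (orient_star y) rfl).1
        (separates_of_lt (star_lt_comm.1 lxy) h)
    · exact h
    · exact absurd (lyz.trans ((lt_star_comm.1 h).trans lxy)).1 (Q.not_star_le y)
    · refine absurd (sxy z ?_) (not_transverse_of_orient_eq (by rw [fxz]))
      exact separates_symm ((separates_congr rfl (orient_star y) rfl).1
        (separates_of_lt lyz (star_lt_star.1 h)))
  refine Or.inr ⟨fxz, lxz, fun m hm => ?_⟩
  by_contra hmt
  obtain ⟨n, hn, h1, h2⟩ :=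
    ((separates_congr rfl (orient_star x) rfl).2 hm).exists_between lxz
  have hnt : ¬ Q'.transverse (f n) (f x) :=
    mt (transverse_congr (hf.orient_eq hn) rfl).1 hmt
  have hyn : Q.disjointHyp y n := by
    refine ⟨?_, fun h => hnt (fxy ▸ transverse_symm (hf.am2 _ _ h))⟩
    rintro (rfl | rfl)
    · exact lyz.not_star_lt (by rwa [Q.star_star])
    · exact lxy.not_lt_star h1
  rcases OnSide.of_disjoint hyn with (h | h) | h | h
  · exact lyz.not_star_lt (by rw [Q.star_star]; exact h.trans h2)
  · exact hnt (fxy ▸ syz n ((separates_congr rfl (orient_star y) rfl).1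
      (separates_of_lt h h2)))
  · exact lxy.not_lt_star (h1.trans (lt_star_comm.1 h))
  · exact hnt (sxy n ((separates_congr rfl (orient_star x) rfl).1
      (separates_of_lt h1 (star_lt_star.1 h))))

theorem TightFacing.smul {G : Type w} [Group G] [MulAction G P] [MulAction G P']
    (hG : Q.IsGAction G) (hG' : Q'.IsGAction G) (hequi : Equivariant G f) (g : G)
    (h : TightFacing Q Q' f x y) : TightFacing Q Q' f (g • x) (g • y) := by
  refine ⟨by rw [hequi, hequi, h.1], ?_, fun m hm => ?_⟩
  · rw [← hG.smul_star]
    exact hG.smul_lt g h.2.1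
  · have hs := hG.smul_separates g⁻¹ hm
    rw [inv_smul_smul, inv_smul_smul] at hs
    have ht := hG'.smul_transverse g (h.2.2 _ hs)
    rwa [← hequi, ← hequi, smul_inv_smul] at ht

/-- Distinct halfspaces identified by an elementary fold are translates of a tightly facing
pair, in the orientation `O` given by the orbit of the folded pair. -/
theorem IsFoldRel.eq_or_tightFacing {G : Type w} [Group G] [MulAction G P] [MulAction G P']
    (hG : Q.IsGAction G) (hG' : Q'.IsGAction G) (hf : IsAdmissibleMap Q Q' f)
    (hequi : Equivariant G f) {r : P → P → Prop} (hrel : Q.IsFoldRel G h₁ h₂ r)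
    (htight : TightFacing Q Q' f h₁ h₂) {O : P → Prop}
    (hO : ∀ x, O x ↔ ∃ g : G, f x = g • f h₁) (hOs : ∀ x, O x → ¬ O (Q.star x))
    (hxy : r x y) :
    x = y ∨ O x ∧ TightFacing Q Q' f x y ∨
      O (Q.star x) ∧ TightFacing Q Q' f (Q.star x) (Q.star y) := by
  have hOf : ∀ {u v}, f u = f v → (O u ↔ O v) := fun {u v} h => by rw [hO, hO, h]
  have hOg : ∀ (g : G) {u}, O u → O (g • u) := fun g {u} h => by
    rw [hO] at h ⊢
    obtain ⟨g', h⟩ := h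
    exact ⟨g * g', by rw [hequi, h, mul_smul]⟩
  refine hrel.min (fun x y => x = y ∨ O x ∧ TightFacing Q Q' f x y ∨
    O (Q.star x) ∧ TightFacing Q Q' f (Q.star x) (Q.star y))
    ⟨fun _ => Or.inl rfl, ?_, ?_⟩ ?_ ?_ ?_ x y hxy
  · rintro x y (rfl | ⟨h, ht⟩ | ⟨h, ht⟩)
    · exact Or.inl rfl
    · exact Or.inr (Or.inl ⟨(hOf ht.1).1 h, ht.symm⟩)
    · exact Or.inr (Or.inr ⟨(hOf ht.1).1 h, ht.symm⟩)
  · rintro x y z (rfl | ⟨h, ht⟩ | ⟨h, ht⟩) hyz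
    · exact hyz
    · rcases hyz with rfl | ⟨h', ht'⟩ | ⟨h', ht'⟩
      · exact Or.inr (Or.inl ⟨h, ht⟩)
      · exact (ht.trans hf ht').imp id fun ht'' => Or.inl ⟨h, ht''⟩
      · exact absurd h' (hOs _ ((hOf ht.1).1 h))
    · rcases hyz with rfl | ⟨h', ht'⟩ | ⟨h', ht'⟩
      · exact Or.inr (Or.inr ⟨h, ht⟩)
      · exact absurd ((hOf ht.1).1 h) (hOs _ h')
      · refine (ht.trans hf ht').imp (fun h => ?_) fun ht'' => Or.inr ⟨h, ht''⟩
        rw [← Q.star_star x, h, Q.star_star]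
  · rintro g x y (rfl | ⟨h, ht⟩ | ⟨h, ht⟩)
    · exact Or.inl rfl
    · exact Or.inr (Or.inl ⟨hOg g h, ht.smul hG hG' hequi g⟩)
    · have ht' := ht.smul hG hG' hequi g
      rw [hG.smul_star, hG.smul_star] at ht'
      exact Or.inr (Or.inr ⟨hG.smul_star g x ▸ hOg g h, ht'⟩)
  · rintro x y (rfl | ⟨h, ht⟩ | h)
    · exact Or.inl rfl
    · exact Or.inr (Or.inr (by simpa only [Q.star_star] using ⟨h, ht⟩))
    · exact Or.inr (Or.inl h)
  · exact Or.inr (Or.inl ⟨(hO _).2 ⟨1, (one_smul _ _).symm⟩, htight⟩)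

theorem IsFoldRel.isNestedFold {G : Type w} [Group G] [MulAction G P] [MulAction G P']
    (hG : Q.IsGAction G) (hG' : Q'.IsGAction G) (hres : IsResolution Q Q' f)
    (hequi : Equivariant G f) (hfold : ElemFoldable Q Q' f h₁ h₂) {r : P → P → Prop}
    (hrel : Q.IsFoldRel G h₁ h₂ r) {A : Set P'}
    (hA : ∀ a ∈ A, ∀ b ∈ A, ¬ Q'.transverse a b) :
    Q.IsNestedFold r (fun x => ∃ g : G, f x = g • f h₁)
      (fun x => ∃ a ∈ A, Q'.orient (f x) = Q'.orient a) := by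
  have hf := hres.adm
  have nested : ∀ {x y}, (∃ a ∈ A, Q'.orient (f x) = Q'.orient a) →
      (∃ a ∈ A, Q'.orient (f y) = Q'.orient a) → ¬ Q'.transverse (f x) (f y) := by
    rintro x y ⟨a, ha, hxa⟩ ⟨b, hb, hyb⟩ h
    exact hA a ha b hb ((transverse_congr hxa hyb).1 h)
  have hOs : ∀ x, (∃ g : G, f x = g • f h₁) → ¬ ∃ g : G, f (Q.star x) = g • f h₁ := by
    rintro x ⟨g, hg⟩ ⟨g', hg'⟩
    refine hG'.no_inversion (g' * g⁻¹) (g • f h₁) ?_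
    rw [mul_smul, inv_smul_smul, ← hg', hf.am1, hg]
  have key : ∀ {x y}, r x y → _ := fun {x y} hxy =>
    hrel.eq_or_tightFacing hG hG' hf hequi
      ⟨hfold.2.1, hfold.1, fun m hm => hfold.transverse_of_separates hres hm⟩
      (fun _ => Iff.rfl) hOs hxy
  have image_eq : ∀ {x y}, r x y → f x = f y := fun {x y} hxy => by
    rcases key hxy with rfl | ⟨-, h⟩ | ⟨-, h⟩
    · rfl
    · exact h.1
    · have h' := h.1
      rw [hf.am1, hf.am1] at h'
      rw [← Q'.star_star (f x), h', Q'.star_star]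
  refine ⟨hrel.equiv, fun {x y} => hrel.sinv x y, fun {x y} hxy => ?_, fun {x} => hOs x,
    fun {x y} hxy => ?_, fun {x y} hxy => ?_, fun {x} => ?_, fun {x y} hx hy h => ?_,
    fun {x y m} hxy hx hm hs => ?_⟩
  · rw [image_eq hxy]
    exact id
  · rcases key hxy with h | ⟨h, h'⟩ | ⟨h, h'⟩
    · exact Or.inl h
    · exact Or.inr (Or.inl ⟨h, h'.2.1⟩)
    · exact Or.inr (Or.inr ⟨h, by simpa only [Q.star_star] using h'.2.1⟩)
  · rw [image_eq hxy]
    exact id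
  · rw [hf.orient_eq (star_mem_orient x)]
    exact id
  · exact nested hx hy (hf.am2 _ _ h)
  · refine nested hm hx ?_
    rcases key hxy with rfl | ⟨-, h⟩ | ⟨-, h⟩
    · obtain ⟨h1, h2⟩ | ⟨h1, h2⟩ := separates_iff.1 hs
      · exact absurd h2 h1.not_star
      · exact absurd h1 h2.not_star
    · exact h.2.2 m hs
    · exact (transverse_congr rfl (hf.orient_eq (star_mem_orient x))).1
        (h.2.2 m ((separates_congr rfl (orient_star x) (orient_star y)).2 hs))

end Fold

end Pocset


/-- if `k̂` separates `ĥ` and `l̂`, the images under `f` are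
pairwise non-transverse, and `[k̂]` no longer separates `[ĥ]` and `[l̂]`
after an elementary fold, then `ĥ ∼ k̂`, or `l̂ ∼ k̂`, or `[ĥ]`, `[k̂]`,
`[l̂]` form a facing triple; in the latter case exactly two elements of
`[k̂]` separate `ĥ` and `l̂`. -/
theorem separated_hyperplanes_after_fold {P : Type u} {P' : Type v}
    (Q : Pocset P) (Q' : Pocset P')
    (hLF : Q.LocallyFinite) (hLF' : Q'.LocallyFinite)
    (G : Type w) [Group G] [MulAction G P] [MulAction G P']
    (hG : Q.IsGAction G) (hG' : Q'.IsGAction G)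
    (f : P → P') (hres : Pocset.IsResolution Q Q' f)
    (hequi : Pocset.Equivariant G f)
    (h₁ h₂ : P) (hfold : Pocset.ElemFoldable Q Q' f h₁ h₂)
    (r : P → P → Prop) (hrel : Q.IsFoldRel G h₁ h₂ r)
    (h k l : P) (hsep : Q.separates k h l)
    (hhk : ¬ Q'.transverse (f h) (f k))
    (hhl : ¬ Q'.transverse (f h) (f l))
    (hkl : ¬ Q'.transverse (f k) (f l))
    (hq : ¬ Q.QuotSeparates r k h l) :
    Q.hypRel r h k ∨ Q.hypRel r l k ∨
    ((∃ a ∈ Q.orient h, ∃ b ∈ Q.orient k, ∃ c ∈ Q.orient l,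
        Q.QuotFacing r a b ∧ Q.QuotFacing r b c ∧ Q.QuotFacing r a c) ∧
      (∃ m₁ m₂ : P, Q.hypRel r k m₁ ∧ Q.hypRel r k m₂ ∧ ¬ Q.sameHyp m₁ m₂ ∧
        Q.separates m₁ h l ∧ Q.separates m₂ h l ∧
        ∀ m : P, Q.hypRel r k m → Q.separates m h l →
          Q.sameHyp m m₁ ∨ Q.sameHyp m m₂)) := by
  have F := hrel.isNestedFold (A := {f h, f k, f l}) hG hG' hres hequi hfold (by
    have hself : ∀ a, ¬ Q'.transverse a a := fun a =>
      Pocset.not_transverse_of_orient_eq rfl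
    have hkh := mt Pocset.transverse_symm hhk
    have hlh := mt Pocset.transverse_symm hhl
    have hlk := mt Pocset.transverse_symm hkl
    rintro a (rfl | rfl | rfl) b (rfl | rfl | rfl) <;> first | assumption | exact hself _)
  obtain ⟨a, ha, b, hb, c, hc, hab, hbc⟩ := hsep
  have hcongr : ∀ {x y x' y'}, x ∈ Q.orient x' → y ∈ Q.orient y' →
      (Q.hypRel r x y ↔ Q.hypRel r x' y') := fun hx hy =>
    Pocset.hypRel_congr hrel.sinv hx hy
  have hm : ∀ m, Q.hypRel r b m ↔ Q.hypRel r k m := fun m =>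
    hcongr hb (Pocset.self_mem_orient m)
  have hs : ∀ m, Q.separates m a c ↔ Q.separates m h l := fun m =>
    Pocset.separates_congr rfl (Pocset.orient_eq ha) (Pocset.orient_eq hc)
  have hq' : ¬ Q.QuotSeparates r b a c := by
    rwa [Pocset.QuotSeparates, Pocset.orient_eq ha, Pocset.orient_eq hb, Pocset.orient_eq hc]
  have main := F.trichotomy ⟨f h, by simp, hres.adm.orient_eq ha⟩
    ⟨f k, by simp, hres.adm.orient_eq hb⟩ ⟨f l, by simp, hres.adm.orient_eq hc⟩ hab hbc hq'
  simpa only [hcongr ha hb, hcongr hc hb, hm, hs, Pocset.orient_eq ha, Pocset.orient_eq hb,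
    Pocset.orient_eq hc] using main
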